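/- Let ε > 0, let W : (−ε, 1) → ℝ be twice continuously differentiable with W′(0) < 0 and W″(0) < W′(0), and set r₀ = √(−8·W′(0)). Then: (a) there exists η > 0 such that for every r with 0 ≤ r < r₀, U_r′(u) ≠ 0 for all u with 0 < |u| < η (so u = 0 is the only critical point of U_r near 0, and it is a strict local maximum); (b) there exist δ > 0 and a continuous function β : (r₀, r₀ + δ) → (0, η) such that for every r ∈ (r₀, r₀ + δ), U_r′(β(r)) = 0 and β(r) is a strict local maximum of U_r, while u = 0 is a strict local minimum of U_r, and β(r) → 0 as r → r₀ from above. -/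

import Mathlib

/-- The function `v(u) = (1 - √(1-u²))/u` for `u ≠ 0`, `v(0) = 0`. -/
noncomputable def v (u : ℝ) : ℝ := if u = 0 then 0 else (1 - Real.sqrt (1 - u ^ 2)) / u

/-- The effective potential `U_r(u) = (r²/2) v(u)² + W(u²)`. -/
noncomputable def effU (r : ℝ) (W : ℝ → ℝ) (u : ℝ) : ℝ := r ^ 2 / 2 * (v u) ^ 2 + W (u ^ 2)

open Set Filter Topology

/-- The square of `v`, as a function of `s = u²`. -/
noncomputable def vSq (s : ℝ) : ℝ := (1 - √(1 - s)) / (1 + √(1 - s))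

/-- The value of `r² / 2` for which `s = u²` is a critical point of the effective potential. -/
noncomputable def critLevel (W : ℝ → ℝ) (s : ℝ) : ℝ :=
  -deriv W s * (√(1 - s) * (1 + √(1 - s)) ^ 2)

theorem v_sq_eq {u : ℝ} (hu : u ^ 2 < 1) : v u ^ 2 = vSq (u ^ 2) := by
  have hq := Real.sqrt_nonneg (1 - u ^ 2)
  have hq2 := Real.sq_sqrt (show 0 ≤ 1 - u ^ 2 by linarith)
  by_cases h : u = 0
  · simp [v, vSq, h]
  · simp only [v, vSq, h, if_false]
    set q := √(1 - u ^ 2)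
    have : 1 + q ≠ 0 := by positivity
    field_simp
    linear_combination (q - 1) * hq2

theorem effU_eq {r : ℝ} {W : ℝ → ℝ} {u : ℝ} (hu : u ^ 2 < 1) :
    effU r W u = r ^ 2 / 2 * vSq (u ^ 2) + W (u ^ 2) := by
  rw [effU, v_sq_eq hu]

theorem hasDerivAt_sqrt_one_sub {s : ℝ} (hs : s < 1) :
    HasDerivAt (fun s : ℝ => √(1 - s)) (-1 / (2 * √(1 - s))) s :=
  ((hasDerivAt_id s).const_sub 1).sqrt (by simp only [id]; linarith)

theorem hasDerivAt_vSq {s : ℝ} (hs : s < 1) :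
    HasDerivAt vSq (1 / (√(1 - s) * (1 + √(1 - s)) ^ 2)) s := by
  have hq : 0 < √(1 - s) := Real.sqrt_pos.2 (by linarith)
  have hd := hasDerivAt_sqrt_one_sub hs
  refine ((hd.const_sub 1).div (hd.const_add 1) (by positivity)).congr_deriv ?_
  field_simp
  ring

theorem hasDerivAt_radial {r : ℝ} {W : ℝ → ℝ} {s : ℝ} (hs : s < 1)
    (hW : DifferentiableAt ℝ W s) :
    HasDerivAt (fun s => r ^ 2 / 2 * vSq s + W s)
      (1 / (√(1 - s) * (1 + √(1 - s)) ^ 2) * (r ^ 2 / 2 - critLevel W s)) s := by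
  have hq : 0 < √(1 - s) := Real.sqrt_pos.2 (by linarith)
  refine (((hasDerivAt_vSq hs).const_mul (r ^ 2 / 2)).add hW.hasDerivAt).congr_deriv ?_
  rw [critLevel]
  field_simp
  ring

theorem deriv_effU {r : ℝ} {W : ℝ → ℝ} {u : ℝ} (hu : u ^ 2 < 1)
    (hW : DifferentiableAt ℝ W (u ^ 2)) :
    deriv (effU r W) u = 1 / (√(1 - u ^ 2) * (1 + √(1 - u ^ 2)) ^ 2) *
      (r ^ 2 / 2 - critLevel W (u ^ 2)) * (2 * u) := by
  have hev : effU r W =ᶠ[𝓝 u] fun u => r ^ 2 / 2 * vSq (u ^ 2) + W (u ^ 2) := by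
    have : ∀ᶠ x : ℝ in 𝓝 u, x ^ 2 < 1 :=
      (continuous_pow 2).continuousAt.eventually_lt continuousAt_const hu
    filter_upwards [this] with x hx using effU_eq hx
  rw [hev.deriv_eq]
  have h2 : HasDerivAt (fun u : ℝ => u ^ 2) (2 * u) u := by
    simpa using hasDerivAt_pow 2 u
  exact (HasDerivAt.comp (h := fun u : ℝ => u ^ 2) u
    (hasDerivAt_radial hu hW) h2).deriv

theorem radial_deriv_weight_pos {s : ℝ} (hs : s < 1) :
    0 < 1 / (√(1 - s) * (1 + √(1 - s)) ^ 2) := by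
  have hq : 0 < √(1 - s) := Real.sqrt_pos.2 (by linarith)
  positivity

theorem radial_strictMonoOn {r b c : ℝ} {W : ℝ → ℝ} (hc : c < 1)
    (hW : ∀ s ∈ Icc b c, DifferentiableAt ℝ W s)
    (h : ∀ s ∈ Ioo b c, critLevel W s < r ^ 2 / 2) :
    StrictMonoOn (fun s => r ^ 2 / 2 * vSq s + W s) (Icc b c) := by
  refine strictMonoOn_of_deriv_pos (convex_Icc b c) (fun s hs =>
    (hasDerivAt_radial (hs.2.trans_lt hc) (hW s hs)).continuousAt.continuousWithinAt) ?_
  intro s hs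
  rw [interior_Icc] at hs
  rw [(hasDerivAt_radial (hs.2.trans hc) (hW s (Ioo_subset_Icc_self hs))).deriv]
  exact mul_pos (radial_deriv_weight_pos (hs.2.trans hc)) (sub_pos.2 (h s hs))

theorem radial_strictAntiOn {r b c : ℝ} {W : ℝ → ℝ} (hc : c < 1)
    (hW : ∀ s ∈ Icc b c, DifferentiableAt ℝ W s)
    (h : ∀ s ∈ Ioo b c, r ^ 2 / 2 < critLevel W s) :
    StrictAntiOn (fun s => r ^ 2 / 2 * vSq s + W s) (Icc b c) := by
  refine strictAntiOn_of_deriv_neg (convex_Icc b c) (fun s hs =>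
    (hasDerivAt_radial (hs.2.trans_lt hc) (hW s hs)).continuousAt.continuousWithinAt) ?_
  intro s hs
  rw [interior_Icc] at hs
  rw [(hasDerivAt_radial (hs.2.trans hc) (hW s (Ioo_subset_Icc_self hs))).deriv]
  exact mul_neg_of_pos_of_neg (radial_deriv_weight_pos (hs.2.trans hc)) (sub_neg.2 (h s hs))

theorem critLevel_zero (W : ℝ → ℝ) : critLevel W 0 = -4 * deriv W 0 := by
  simp [critLevel]; ring

theorem deriv_critLevel_zero {W : ℝ → ℝ} (hW : DifferentiableAt ℝ (deriv W) 0) :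
    deriv (critLevel W) 0 = 4 * (deriv W 0 - deriv (deriv W) 0) := by
  have hd := hasDerivAt_sqrt_one_sub zero_lt_one
  have := (hW.hasDerivAt.neg.mul (hd.mul ((hd.const_add 1).pow 2))).deriv
  refine Eq.trans ?_ (this.trans ?_)
  · rfl
  · simp; ring

theorem contDiffAt_critLevel {W : ℝ → ℝ} {s : ℝ} (hs : s < 1)
    (hW : ContDiffAt ℝ 1 (deriv W) s) : ContDiffAt ℝ 1 (critLevel W) s := by
  have hq : ContDiffAt ℝ 1 (fun s : ℝ => √(1 - s)) s :=
    (contDiffAt_const.sub contDiffAt_id).sqrt (by simp only [id]; linarith)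
  exact hW.neg.mul (hq.mul ((contDiffAt_const.add hq).pow 2))

theorem exists_strictMonoOn_critLevel {ε : ℝ} (hε : 0 < ε) {W : ℝ → ℝ}
    (hW : ContDiffOn ℝ 2 W (Ioo (-ε) 1)) (hW2 : deriv (deriv W) 0 < deriv W 0) :
    ∃ a > 0, a < 1 ∧ StrictMonoOn (critLevel W) (Icc 0 a) ∧
      ContinuousOn (critLevel W) (Icc 0 a) := by
  have hW' : ContDiffOn ℝ 1 (deriv W) (Ioo (-ε) 1) :=
    ((contDiffOn_succ_iff_deriv_of_isOpen (n := 1) isOpen_Ioo).1 hW).2.2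
  have hcd : ∀ s ∈ Ioo (-ε) 1, ContDiffAt ℝ 1 (critLevel W) s := fun s hs =>
    contDiffAt_critLevel hs.2 (hW'.contDiffAt (isOpen_Ioo.mem_nhds hs))
  have h0 : (0 : ℝ) ∈ Ioo (-ε) 1 := ⟨by linarith, one_pos⟩
  have hder : ContinuousOn (deriv (critLevel W)) (Ioo (-ε) 1) :=
    ((contDiffOn_succ_iff_deriv_of_isOpen (n := 0) isOpen_Ioo).1
      (fun s hs => (hcd s hs).contDiffWithinAt)).2.2.continuousOn
  have hpos : 0 < deriv (critLevel W) 0 := by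
    rw [deriv_critLevel_zero ((hW'.contDiffAt (isOpen_Ioo.mem_nhds h0)).differentiableAt
      one_ne_zero)]
    linarith
  have hev : ∀ᶠ s in 𝓝 0, 0 < deriv (critLevel W) s :=
    continuousAt_const.eventually_lt (hder.continuousAt (isOpen_Ioo.mem_nhds h0)) hpos
  obtain ⟨ρ, hρ, hball⟩ := Metric.eventually_nhds_iff.1 hev
  have hlt : min (ρ / 2) (1 / 2) < 1 := (min_le_right _ _).trans_lt (by norm_num)
  have hcont : ContinuousOn (critLevel W) (Icc 0 (min (ρ / 2) (1 / 2))) := fun s hs =>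
    (hcd s ⟨by linarith [hs.1], hs.2.trans_lt hlt⟩).continuousAt.continuousWithinAt
  refine ⟨min (ρ / 2) (1 / 2), by positivity, hlt, ?_, hcont⟩
  refine strictMonoOn_of_deriv_pos (convex_Icc _ _) hcont fun s hs => ?_
  rw [interior_Icc] at hs
  have := hs.2.trans_le (min_le_left _ _)
  exact hball (by rw [Real.dist_eq, sub_zero, abs_of_pos hs.1]; linarith)

/-- A continuous strictly increasing function on `[0, a]` has a continuous inverse on the
open interval of its values, which tends to `0` at the left end. -/
theorem exists_continuousOn_inverse {h : ℝ → ℝ} {a : ℝ} (ha : 0 < a)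
    (hm : StrictMonoOn h (Icc 0 a)) (hc : ContinuousOn h (Icc 0 a)) :
    ∃ σ : ℝ → ℝ, (∀ y ∈ Ioo (h 0) (h a), σ y ∈ Ioo 0 a ∧ h (σ y) = y) ∧
      ContinuousOn σ (Ioo (h 0) (h a)) ∧ Tendsto σ (𝓝[>] h 0) (𝓝 0) := by
  have hex : ∀ y, ∃ s, y ∈ Ioo (h 0) (h a) → s ∈ Ioo 0 a ∧ h s = y := by
    intro y
    by_cases hy : y ∈ Ioo (h 0) (h a)
    · obtain ⟨s, hs, hsy⟩ := intermediate_value_Ioo ha.le hc hy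
      exact ⟨s, fun _ => ⟨hs, hsy⟩⟩
    · exact ⟨0, fun h => absurd h hy⟩
  choose σ hσ using hex
  have h0 : (0 : ℝ) ∈ Icc 0 a := ⟨le_rfl, ha.le⟩
  have hmono : StrictMonoOn σ (Ioo (h 0) (h a)) := fun x hx y hy hxy => by
    rw [← hm.lt_iff_lt (Ioo_subset_Icc_self (hσ x hx).1) (Ioo_subset_Icc_self (hσ y hy).1),
      (hσ x hx).2, (hσ y hy).2]
    exact hxy
  refine ⟨σ, hσ, fun y hy => ?_, ?_⟩
  · refine (hmono.continuousAt_of_image_mem_nhds (isOpen_Ioo.mem_nhds hy)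
      (mem_of_superset (isOpen_Ioo.mem_nhds (hσ y hy).1) fun s hs => ?_)).continuousWithinAt
    have hs' := Ioo_subset_Icc_self hs
    have hys : h s ∈ Ioo (h 0) (h a) :=
      ⟨hm h0 hs' hs.1, hm hs' ⟨ha.le, le_rfl⟩ hs.2⟩
    exact ⟨h s, hys, hm.injOn (Ioo_subset_Icc_self (hσ _ hys).1) hs' (hσ _ hys).2⟩
  · rw [tendsto_order]
    have hlt : h 0 < h a := hm h0 ⟨ha.le, le_rfl⟩ ha
    constructor
    · intro b hb
      filter_upwards [Ioo_mem_nhdsGT hlt] with y hy using hb.trans (hσ y hy).1.1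
    · intro b hb
      have hmem : min b a ∈ Icc 0 a := ⟨by positivity, min_le_right _ _⟩
      filter_upwards [Ioo_mem_nhdsGT hlt, Ioo_mem_nhdsGT (hm h0 hmem (by positivity))]
        with y hy hy'
      have : σ y < min b a := by
        rw [← hm.lt_iff_lt (Ioo_subset_Icc_self (hσ y hy).1) hmem, (hσ y hy).2]
        exact hy'.2
      exact this.trans_le (min_le_left _ _)

/-- Suppose `W` is `C²` with `W''(0) < W'(0) < 0`, and set `r₀ = √(-8 W'(0))`.
(a) For `0 ≤ r < r₀` the origin is the only critical point of `U_r` near `0`, and it is a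
strict local maximum.
(b) For `r` slightly above `r₀` a branch `β(r)` of strict local maxima of `U_r` bifurcates
off the origin (while `u = 0` is a strict local minimum of `U_r`), depending continuously
on `r` and tending to `0` as `r → r₀⁺`. -/
theorem effU_hopf_bifurcation_supercritical (ε : ℝ) (hε : 0 < ε) (W : ℝ → ℝ)
    (hW : ContDiffOn ℝ 2 W (Set.Ioo (-ε) 1))
    (hW1 : deriv W 0 < 0) (hW2 : deriv (deriv W) 0 < deriv W 0)
    (r₀ : ℝ) (hr₀ : r₀ = Real.sqrt (-8 * deriv W 0)) :
    ∃ η > 0,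
      (∀ r : ℝ, 0 ≤ r → r < r₀ →
        (∀ u : ℝ, 0 < |u| → |u| < η → deriv (effU r W) u ≠ 0) ∧
        ∃ δ' > 0, ∀ u : ℝ, 0 < |u| → |u| < δ' → effU r W u < effU r W 0) ∧
      ∃ δ > 0, ∃ β : ℝ → ℝ,
        ContinuousOn β (Set.Ioo r₀ (r₀ + δ)) ∧
        (∀ r ∈ Set.Ioo r₀ (r₀ + δ),
          β r ∈ Set.Ioo 0 η ∧
          deriv (effU r W) (β r) = 0 ∧
          (∃ γ > 0, ∀ u : ℝ, u ≠ β r → |u - β r| < γ → effU r W u < effU r W (β r)) ∧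
          ∃ γ > 0, ∀ u : ℝ, 0 < |u| → |u| < γ → effU r W 0 < effU r W u) ∧
        Filter.Tendsto β (nhdsWithin r₀ (Set.Ioi r₀)) (nhds 0) := by
  obtain ⟨a, ha, ha1, hm, hc⟩ := exists_strictMonoOn_critLevel hε hW hW2
  obtain ⟨σ, hσ, hσc, hσ0⟩ := exists_continuousOn_inverse ha hm hc
  have hWd : ∀ s ∈ Icc 0 a, DifferentiableAt ℝ W s := fun s hs =>
    (hW.contDiffAt (isOpen_Ioo.mem_nhds ⟨by linarith [hs.1], hs.2.trans_lt ha1⟩)).differentiableAt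
      two_ne_zero
  have h0 : (0 : ℝ) ∈ Icc 0 a := ⟨le_rfl, ha.le⟩
  have hr₀0 : 0 ≤ r₀ := hr₀ ▸ Real.sqrt_nonneg _
  have hlevel : critLevel W 0 = r₀ ^ 2 / 2 := by
    rw [critLevel_zero, hr₀, Real.sq_sqrt (by linarith)]
    ring
  have hlevel_lt : critLevel W 0 < critLevel W a := hm h0 ⟨ha.le, le_rfl⟩ ha
  have hsq : ∀ u : ℝ, 0 < |u| → |u| < √a → u ^ 2 ∈ Ioo 0 a := fun u hu hua =>
    ⟨by rw [← sq_abs]; positivity, by rw [← sq_abs]; exact (Real.lt_sqrt hu.le).1 hua⟩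
  refine ⟨√a, Real.sqrt_pos.2 ha, fun r hr hrr₀ => ?_, ?_⟩
  · have hr2 : r ^ 2 / 2 < critLevel W 0 := by
      rw [hlevel]
      nlinarith
    have hneg : ∀ s ∈ Ioo 0 a, r ^ 2 / 2 < critLevel W s := fun s hs =>
      hr2.trans (hm h0 (Ioo_subset_Icc_self hs) hs.1)
    refine ⟨fun u hu hua => ?_, √a, Real.sqrt_pos.2 ha, fun u hu hua => ?_⟩
    · have hs := hsq u hu hua
      rw [deriv_effU (hs.2.trans ha1) (hWd _ (Ioo_subset_Icc_self hs))]
      exact mul_ne_zero (mul_ne_zero (radial_deriv_weight_pos (hs.2.trans ha1)).ne'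
        (sub_neg.2 (hneg _ hs)).ne) (mul_ne_zero two_ne_zero (abs_pos.1 hu))
    · have hs := hsq u hu hua
      rw [effU_eq (hs.2.trans ha1), effU_eq (by norm_num), zero_pow two_ne_zero]
      exact radial_strictAntiOn ha1 hWd hneg h0 (Ioo_subset_Icc_self hs) hs.1
  · have hr₁ : r₀ < √(2 * critLevel W a) := (Real.lt_sqrt hr₀0).2 (by linarith)
    have hmaps : MapsTo (fun r : ℝ => r ^ 2 / 2) (Ioo r₀ (√(2 * critLevel W a)))
        (Ioo (critLevel W 0) (critLevel W a)) := fun r hr => by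
      have h1 := (Real.lt_sqrt (hr₀0.trans hr.1.le)).1 hr.2
      have h2 := pow_lt_pow_left₀ hr.1 hr₀0 two_ne_zero
      constructor <;> simp only <;> linarith
    have hcont : Continuous fun r : ℝ => r ^ 2 / 2 := by fun_prop
    refine ⟨√(2 * critLevel W a) - r₀, sub_pos.2 hr₁, fun r => √(σ (r ^ 2 / 2)), ?_⟩
    rw [add_sub_cancel]
    refine ⟨(hσc.comp hcont.continuousOn hmaps).sqrt, fun r hr => ?_, ?_⟩
    · obtain ⟨hs, hrs⟩ := hσ _ (hmaps hr)
      simp only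
      set s := σ (r ^ 2 / 2)
      have hβ2 : √s ^ 2 = s := Real.sq_sqrt hs.1.le
      have hβ0 : 0 < √s := Real.sqrt_pos.2 hs.1
      have hβa : √s < √a := Real.sqrt_lt_sqrt hs.1.le hs.2
      have hs1 : s < 1 := hs.2.trans ha1
      have hinc : StrictMonoOn (fun s => r ^ 2 / 2 * vSq s + W s) (Icc 0 s) :=
        radial_strictMonoOn hs1 (fun t ht => hWd t ⟨ht.1, ht.2.trans hs.2.le⟩) fun t ht =>
          (hm ⟨ht.1.le, (ht.2.trans hs.2).le⟩ (Ioo_subset_Icc_self hs) ht.2).trans_eq hrs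
      have hdec : StrictAntiOn (fun s => r ^ 2 / 2 * vSq s + W s) (Icc s a) :=
        radial_strictAntiOn ha1 (fun t ht => hWd t ⟨hs.1.le.trans ht.1, ht.2⟩) fun t ht =>
          hrs.symm.trans_lt
            (hm (Ioo_subset_Icc_self hs) ⟨(hs.1.trans ht.1).le, ht.2.le⟩ ht.1)
      refine ⟨⟨hβ0, hβa⟩, ?_, ⟨min √s (√a - √s), lt_min hβ0 (sub_pos.2 hβa), ?_⟩,
        √s, hβ0, fun u hu hus => ?_⟩
      · rw [deriv_effU (hβ2.trans_lt hs1) (hβ2.symm ▸ hWd s (Ioo_subset_Icc_self hs)), hβ2, hrs]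
        simp
      · intro u hne hu
        have hu1 := abs_lt.1 (hu.trans_le (min_le_left _ _))
        have hu2 := abs_lt.1 (hu.trans_le (min_le_right _ _))
        have hu0 : 0 < u := by linarith
        have hua := hsq u (abs_pos_of_pos hu0) (by rw [abs_of_pos hu0]; linarith)
        rw [effU_eq (hua.2.trans ha1), effU_eq (hβ2.trans_lt hs1), hβ2]
        rcases lt_or_gt_of_ne hne with hlt | hgt
        · have hlt' := (Real.lt_sqrt hu0.le).1 hlt
          exact hinc ⟨hua.1.le, hlt'.le⟩ ⟨hs.1.le, le_rfl⟩ hlt'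
        · have hgt' := (Real.sqrt_lt' hu0).1 hgt
          exact hdec ⟨le_rfl, hs.2.le⟩ ⟨hgt'.le, hua.2.le⟩ hgt'
      · have hus2 : u ^ 2 < s := by rw [← sq_abs]; exact (Real.lt_sqrt hu.le).1 hus
        have hua := hsq u hu (hus.trans hβa)
        rw [effU_eq (hua.2.trans ha1), effU_eq (by norm_num), zero_pow two_ne_zero]
        exact hinc ⟨le_rfl, hs.1.le⟩ ⟨hua.1.le, hus2.le⟩ hua.1
    · have ht : Tendsto (fun r : ℝ => r ^ 2 / 2) (𝓝[>] r₀) (𝓝[>] critLevel W 0) := by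
        refine tendsto_nhdsWithin_iff.2 ⟨hlevel ▸ hcont.continuousAt.continuousWithinAt, ?_⟩
        filter_upwards [Ioo_mem_nhdsGT hr₁] with r hr using (hmaps hr).1
      simpa using (hσ0.comp ht).sqrt
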